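/- arXiv:2107.11064 — 7 statements merged into one kernel-verified Lean document; each statement's English description precedes it below -/
import Mathlib

section
/- Let f : ℝ → ℝ be defined for ν ≥ 1 by f(ν) = ((ν+1)/2)·ln((ν+1)/2) − ((ν−1)/2)·ln((ν−1)/2), where the second term is interpreted as 0 when ν = 1. Then for every ν ≥ 1 one has ln ν ≤ f(ν) ≤ ln ν + 1 − ln 2. -/
/-- The von Neumann entropy contribution of a single symplectic eigenvalue `ν ≥ 1`
of the covariance matrix of a bosonic Gaussian state.  Note that in Mathlib
`Real.log 0 = 0`, so at `ν = 1` the second term is automatically interpreted as `0`. -/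
noncomputable def gaussianEntropy (ν : ℝ) : ℝ :=
  ((ν + 1) / 2) * Real.log ((ν + 1) / 2) - ((ν - 1) / 2) * Real.log ((ν - 1) / 2)

lemma aux_upper (x : ℝ) (h0 : 0 ≤ x) (h1 : x ≤ 1) :
    (1 + x) * Real.log (1 + x) - (1 - x) * Real.log (1 - x) ≤ 2 * x := by
  have hc : Continuous (fun x : ℝ =>
      (1 + x) * Real.log (1 + x) - (1 - x) * Real.log (1 - x) - 2 * x) := by
    have c1 : Continuous (fun x : ℝ => (1 + x) * Real.log (1 + x)) :=
      Real.continuous_mul_log.comp (by fun_prop : Continuous (fun x : ℝ => 1 + x))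
    have c2 : Continuous (fun x : ℝ => (1 - x) * Real.log (1 - x)) :=
      Real.continuous_mul_log.comp (by fun_prop : Continuous (fun x : ℝ => 1 - x))
    exact (c1.sub c2).sub (by fun_prop)
  have hd : ∀ x ∈ interior (Set.Icc (0 : ℝ) 1), HasDerivAt (fun x : ℝ =>
      (1 + x) * Real.log (1 + x) - (1 - x) * Real.log (1 - x) - 2 * x)
      (Real.log (1 + x) + Real.log (1 - x)) x := by
    intro x hx
    rw [interior_Icc] at hx
    obtain ⟨hx0, hx1⟩ := hx
    have e1 := (Real.hasDerivAt_mul_log (x := 1 + x) (by linarith)).comp x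
      ((hasDerivAt_id x).const_add 1)
    have e2 := (Real.hasDerivAt_mul_log (x := 1 - x) (by linarith)).comp x
      ((hasDerivAt_id x).const_sub 1)
    have e3 := (hasDerivAt_id x).const_mul 2
    refine ((e1.sub e2).sub e3).congr_deriv ?_
    ring
  have hanti := antitoneOn_of_deriv_nonpos (convex_Icc (0 : ℝ) 1) hc.continuousOn
    (fun x hx => (hd x hx).differentiableAt.differentiableWithinAt) (by
      intro x hx
      rw [(hd x hx).deriv]
      rw [interior_Icc] at hx
      obtain ⟨hx0, hx1⟩ := hx
      rw [← Real.log_mul (by linarith) (by linarith)]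
      exact Real.log_nonpos (by nlinarith) (by nlinarith))
  have := hanti (Set.left_mem_Icc.2 zero_le_one) ⟨h0, h1⟩ h0
  simp at this
  linarith

lemma aux_lower (r : ℝ) (h0 : 0 < r) (h1 : r < 1) :
    r * Real.log r + (1 - r) * Real.log (1 + r) ≤ 0 := by
  have h := strictConcaveOn_log_Ioi.concaveOn.2 (x := r) (y := 1 + r) h0
    (by simp; linarith) h0.le (by linarith : 0 ≤ 1 - r) (by ring)
  simp only [smul_eq_mul] at h
  rwa [show r * r + (1 - r) * (1 + r) = 1 by ring, Real.log_one] at h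

/-- The bounding corridor `ln ν ≤ f(ν) ≤ ln ν + 1 − ln 2` between the Rényi-2 entropy
contribution `ln ν` and the von Neumann entropy contribution `f(ν)` of a single
symplectic eigenvalue `ν ≥ 1`. -/
theorem gaussianEntropy_corridor (ν : ℝ) (hν : 1 ≤ ν) :
    Real.log ν ≤ gaussianEntropy ν ∧
    gaussianEntropy ν ≤ Real.log ν + 1 - Real.log 2 := by
  unfold gaussianEntropy
  rcases hν.eq_or_lt with rfl | hlt
  · have := Real.log_two_lt_d9
    norm_num
    linarith
  have hn : 0 < ν := by linarith
  have e1 : Real.log ((ν + 1) / 2) = Real.log (ν + 1) - Real.log 2 :=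
    Real.log_div (by linarith) (by norm_num)
  have e2 : Real.log ((ν - 1) / 2) = Real.log (ν - 1) - Real.log 2 :=
    Real.log_div (by linarith) (by norm_num)
  rw [e1, e2]
  constructor
  · have h := aux_lower ((ν - 1) / (ν + 1)) (div_pos (by linarith) (by linarith))
      (by rw [div_lt_one] <;> linarith)
    have e3 : 1 + (ν - 1) / (ν + 1) = 2 * ν / (ν + 1) := by field_simp; ring
    have e4 : 1 - (ν - 1) / (ν + 1) = 2 / (ν + 1) := by field_simp; ring
    rw [e3, e4, Real.log_div (by linarith) (by linarith),
      Real.log_div (by linarith) (by linarith),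
      Real.log_mul (by norm_num) (by linarith)] at h
    have h2 := mul_nonpos_of_nonneg_of_nonpos (by linarith : 0 ≤ (ν + 1) / 2) h
    have e5 : ∀ A B : ℝ, (ν + 1) / 2 * ((ν - 1) / (ν + 1) * A + 2 / (ν + 1) * B)
        = (ν - 1) / 2 * A + B := by
      intro A B
      field_simp
    rw [e5] at h2
    linarith
  · have h := aux_upper (1 / ν) (by positivity) (by rw [div_le_one hn]; exact hν)
    have e3 : 1 + 1 / ν = (ν + 1) / ν := by field_simp
    have e4 : 1 - 1 / ν = (ν - 1) / ν := by field_simp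
    rw [e3, e4, Real.log_div (by linarith) (by linarith),
      Real.log_div (by linarith) (by linarith)] at h
    have h2 := mul_le_mul_of_nonneg_left h (by linarith : 0 ≤ ν / 2)
    have e5 : ∀ A B : ℝ, ν / 2 * ((ν + 1) / ν * A - (ν - 1) / ν * B)
        = (ν + 1) / 2 * A - (ν - 1) / 2 * B := by
      intro A B
      field_simp
    have e6 : ν / 2 * (2 * (1 / ν)) = 1 := by field_simp
    rw [e5, e6] at h2
    linarith
end

section
/- Let f : ℝ → ℝ be defined for ν ≥ 1 by f(ν) = ((ν+1)/2)·ln((ν+1)/2) − ((ν−1)/2)·ln((ν−1)/2), where the second term is interpreted as 0 when ν = 1. Then for every ν ≥ 1 one has f(ν) ≥ ln ν + (1 − ln 2)·(1 − 1/ν²), and moreover f(ν) − ln ν → 1 − ln 2 as ν → ∞. -/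
noncomputable def gaux (x : ℝ) : ℝ :=
  (1 + x) * Real.log (1 + x) - (1 - x) * Real.log (1 - x)

lemma gaux_continuous : Continuous gaux := by
  unfold gaux
  have h := Real.continuous_mul_log
  exact (h.comp (continuous_const.add continuous_id)).sub
    (h.comp (continuous_const.sub continuous_id))

lemma log_one_sub_sq {x : ℝ} (h0 : 0 ≤ x) (h1 : x < 1) :
    Real.log (1 - x ^ 2) = Real.log (1 + x) + Real.log (1 - x) := by
  rw [← Real.log_mul (by linarith) (by linarith)]
  congr 1; ring

lemma gaux_hasDerivAt {x : ℝ} (h0 : 0 ≤ x) (h1 : x < 1) :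
    HasDerivAt gaux (Real.log (1 - x ^ 2) + 2) x := by
  have ha : HasDerivAt (fun y : ℝ => 1 + y) 1 x := (hasDerivAt_id x).const_add 1
  have hb : HasDerivAt (fun y : ℝ => 1 - y) (-1) x := (hasDerivAt_id x).const_sub 1
  have h2 := (ha.mul (ha.log (by linarith))).sub (hb.mul (hb.log (by linarith)))
  refine h2.congr_deriv ?_
  rw [log_one_sub_sq h0 h1]
  have : 1 + x ≠ 0 := by linarith
  have : 1 - x ≠ 0 := by linarith
  field_simp
  ring

lemma sq_lt_one_aux {x : ℝ} (h0 : 0 ≤ x) (h1 : x < 1) : 0 < 1 - x ^ 2 := by nlinarith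

lemma gaux_le {x : ℝ} (h0 : 0 ≤ x) (h1 : x ≤ 1) : gaux x ≤ 2 * x := by
  have hA : AntitoneOn (fun y => gaux y - 2 * y) (Set.Icc 0 1) := by
    apply antitoneOn_of_hasDerivWithinAt_nonpos (convex_Icc 0 1)
      (f' := fun y => Real.log (1 - y ^ 2) + 2 - 2 * 1)
    · exact (gaux_continuous.sub (by fun_prop)).continuousOn
    · intro y hy
      rw [interior_Icc] at hy
      exact ((gaux_hasDerivAt hy.1.le hy.2).sub
        ((hasDerivAt_id y).const_mul 2)).hasDerivWithinAt
    · intro y hy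
      rw [interior_Icc] at hy
      have := Real.log_nonpos (sq_lt_one_aux hy.1.le hy.2).le (by nlinarith [sq_nonneg y])
      linarith
  have := hA ⟨le_rfl, zero_le_one⟩ ⟨h0, h1⟩ h0
  simp [gaux] at this
  simp only [gaux]
  linarith

lemma p_nonneg {x : ℝ} (h0 : 0 ≤ x) (h1 : x < 1) :
    0 ≤ 3 * gaux x - 6 * x - x * Real.log (1 - x ^ 2) := by
  have key : ∀ y : ℝ, 0 ≤ y → y < 1 →
      HasDerivAt (fun y => 3 * gaux y - 6 * y - y * Real.log (1 - y ^ 2))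
        (2 * (Real.log (1 - y ^ 2) + y ^ 2 / (1 - y ^ 2))) y := by
    intro y hy0 hy1
    have hp := sq_lt_one_aux hy0 hy1
    have hq : HasDerivAt (fun y : ℝ => 1 - y ^ 2) (-(2 * y)) y := by
      simpa using (hasDerivAt_pow 2 y).const_sub 1
    have h := (((gaux_hasDerivAt hy0 hy1).const_mul 3).sub
      ((hasDerivAt_id y).const_mul 6)).sub ((hasDerivAt_id y).mul (hq.log hp.ne'))
    refine h.congr_deriv ?_
    have := hp.ne'
    simp only [id]
    field_simp
    ring
  have hM : MonotoneOn (fun y => 3 * gaux y - 6 * y - y * Real.log (1 - y ^ 2))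
      (Set.Ico 0 1) := by
    apply monotoneOn_of_hasDerivWithinAt_nonneg (convex_Ico 0 1)
      (f' := fun y => 2 * (Real.log (1 - y ^ 2) + y ^ 2 / (1 - y ^ 2)))
    · intro y hy
      exact (key y hy.1 hy.2).continuousAt.continuousWithinAt
    · intro y hy
      rw [interior_Ico] at hy
      exact (key y hy.1.le hy.2).hasDerivWithinAt
    · intro y hy
      rw [interior_Ico] at hy
      have hp := sq_lt_one_aux hy.1.le hy.2
      have h := Real.one_sub_inv_le_log_of_pos hp
      have e : y ^ 2 / (1 - y ^ 2) = (1 - y ^ 2)⁻¹ - 1 := by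
        have := hp.ne'
        field_simp
        ring
      rw [e]
      linarith
  have := hM ⟨le_rfl, zero_lt_one⟩ ⟨h0, h1⟩ h0
  simpa [gaux] using this

lemma gaux_ge {x : ℝ} (h0 : 0 < x) (h1 : x ≤ 1) :
    2 * x - 2 * (1 - Real.log 2) * x ^ 3 ≤ gaux x := by
  have hM : MonotoneOn (fun y => (2 * y - gaux y) / y ^ 3) (Set.Ioc 0 1) := by
    apply monotoneOn_of_hasDerivWithinAt_nonneg (convex_Ioc 0 1)
      (f' := fun y => (3 * gaux y - 6 * y - y * Real.log (1 - y ^ 2)) / y ^ 4)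
    · apply ContinuousOn.div
      · exact (Continuous.sub (by fun_prop) gaux_continuous).continuousOn
      · fun_prop
      · intro y hy
        exact pow_ne_zero _ hy.1.ne'
    · intro y hy
      rw [interior_Ioc] at hy
      have h := (((hasDerivAt_id y).const_mul 2).sub (gaux_hasDerivAt hy.1.le hy.2)).div
        (hasDerivAt_pow 3 y) (pow_ne_zero _ hy.1.ne')
      refine (h.congr_deriv ?_).hasDerivWithinAt
      have := hy.1.ne'
      simp only [id, Pi.sub_apply]
      field_simp
      push_cast
      ring
    · intro y hy
      rw [interior_Ioc] at hy
      exact div_nonneg (p_nonneg hy.1.le hy.2) (pow_nonneg hy.1.le _)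
  have := hM ⟨h0, h1⟩ ⟨zero_lt_one, le_rfl⟩ h1
  have e : gaux 1 = 2 * Real.log 2 := by
    unfold gaux
    norm_num
  simp only [e] at this
  rw [div_le_iff₀ (pow_pos h0 3)] at this
  norm_num at this
  linarith

lemma entropy_eq {ν : ℝ} (h : 1 ≤ ν) :
    gaussianEntropy ν - Real.log ν = ν / 2 * gaux (1 / ν) - Real.log 2 := by
  have hν : 0 < ν := by linarith
  unfold gaussianEntropy gaux
  rw [show 1 + 1 / ν = (ν + 1) / ν by field_simp, show 1 - 1 / ν = (ν - 1) / ν by field_simp]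
  rw [Real.log_div (by linarith) (by norm_num), Real.log_div (by linarith) hν.ne']
  rcases h.eq_or_lt with rfl | h
  · norm_num
    ring
  · rw [Real.log_div (by linarith) (by norm_num), Real.log_div (by linarith) hν.ne']
    field_simp
    ring

lemma lower_aux (ν : ℝ) (h : 1 ≤ ν) :
    (1 - Real.log 2) * (1 - 1 / ν ^ 2) ≤ gaussianEntropy ν - Real.log ν := by
  have hν : 0 < ν := by linarith
  rw [entropy_eq h]
  have h1 := gaux_ge (x := 1 / ν) (by positivity) (by rw [div_le_one hν]; exact h)
  have h2 := mul_le_mul_of_nonneg_left h1 (by positivity : 0 ≤ ν / 2)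
  have e : ν / 2 * (2 * (1 / ν) - 2 * (1 - Real.log 2) * (1 / ν) ^ 3)
      = 1 - (1 - Real.log 2) * (1 / ν ^ 2) := by
    field_simp
  rw [e] at h2
  linarith

lemma upper_aux (ν : ℝ) (h : 1 ≤ ν) :
    gaussianEntropy ν - Real.log ν ≤ 1 - Real.log 2 := by
  have hν : 0 < ν := by linarith
  rw [entropy_eq h]
  have h1 := gaux_le (x := 1 / ν) (by positivity) (by rw [div_le_one hν]; exact h)
  have h2 := mul_le_mul_of_nonneg_left h1 (by positivity : 0 ≤ ν / 2)
  have e : ν / 2 * (2 * (1 / ν)) = 1 := by field_simp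
  linarith

/-- Refined lower bound `f(ν) ≥ ln ν + (1 − ln 2)·(1 − 1/ν²)` together with the
asymptotic exactness `f(ν) − ln ν → 1 − ln 2` as `ν → ∞`. -/
theorem gaussianEntropy_refined_bound :
    (∀ ν : ℝ, 1 ≤ ν →
      gaussianEntropy ν ≥ Real.log ν + (1 - Real.log 2) * (1 - 1 / ν ^ 2)) ∧
    Filter.Tendsto (fun ν : ℝ => gaussianEntropy ν - Real.log ν) Filter.atTop
      (nhds (1 - Real.log 2)) := by
  refine ⟨fun ν h => by linarith [lower_aux ν h], ?_⟩
  have hl : Filter.Tendsto (fun ν : ℝ => (1 - Real.log 2) * (1 - 1 / ν ^ 2)) Filter.atTop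
      (nhds (1 - Real.log 2)) := by
    have h0 : Filter.Tendsto (fun ν : ℝ => 1 / ν ^ 2) Filter.atTop (nhds 0) := by
      simp only [one_div]
      exact (Filter.tendsto_pow_atTop (α := ℝ) (n := 2) (by norm_num)).inv_tendsto_atTop
    simpa using (h0.const_sub 1).const_mul (1 - Real.log 2)
  refine tendsto_of_tendsto_of_tendsto_of_le_of_le' hl tendsto_const_nhds ?_ ?_
  · filter_upwards [Filter.eventually_ge_atTop 1] with ν h using lower_aux ν h
  · filter_upwards [Filter.eventually_ge_atTop 1] with ν h using upper_aux ν h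
end

section
/- Let N = N_A + N_B, let F_A = (1_{2N_A} | 0) ∈ ℝ^{2N_A × 2N} select the first 2N_A coordinates and F_B = (0 | 1_{2N_B}) ∈ ℝ^{2N_B × 2N} select the last 2N_B coordinates. Let M be a real 2N × 2N matrix that is symplectic (M Ω Mᵀ = Ω for the standard symplectic form Ω = Ω_{2N}), symmetric, and positive definite, and set Ḡ = M⁻¹. Then Ḡ satisfies the stationarity condition Ḡ⁻¹ = (1/2)·F_Aᵀ (F_A Ḡ F_Aᵀ)⁻¹ F_A + (1/2)·F_Bᵀ (F_B Ḡ F_Bᵀ)⁻¹ F_B + (1/2)·Mᵀ F_Aᵀ (F_A M Ḡ Mᵀ F_Aᵀ)⁻¹ F_A M + (1/2)·Mᵀ F_Bᵀ (F_B M Ḡ Mᵀ F_Bᵀ)⁻¹ F_B M. -/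
open Matrix

/-- The standard symplectic matrix `Ω_{2N} = ⊕_{i=1}^{N} [[0,1],[−1,0]]` of size `2N × 2N`,
in the interleaved quadrature ordering `(q₁, p₁, …, q_N, p_N)`. -/
def stdSymplectic (N : ℕ) : Matrix (Fin (2 * N)) (Fin (2 * N)) ℝ :=
  Matrix.of fun i j =>
    if (i : ℕ) % 2 = 0 ∧ (j : ℕ) = (i : ℕ) + 1 then 1
    else if (j : ℕ) % 2 = 0 ∧ (i : ℕ) = (j : ℕ) + 1 then -1
    else 0

/-- The projection `F_A = (1_{2N_A} | 0)` onto the first `2N_A` coordinates. -/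
def projA (NA NB : ℕ) : Matrix (Fin (2 * NA)) (Fin (2 * (NA + NB))) ℝ :=
  Matrix.of fun i j => if (j : ℕ) = (i : ℕ) then 1 else 0

/-- The projection `F_B = (0 | 1_{2N_B})` onto the last `2N_B` coordinates. -/
def projB (NA NB : ℕ) : Matrix (Fin (2 * NB)) (Fin (2 * (NA + NB))) ℝ :=
  Matrix.of fun i j => if (j : ℕ) = 2 * NA + (i : ℕ) then 1 else 0


theorem schur_aux {a b k : Type*} [Fintype a] [Fintype b] [Fintype k] [DecidableEq a]
    [DecidableEq b] [DecidableEq k] (A : Matrix a k ℝ) (B : Matrix b k ℝ) (M : Matrix k k ℝ)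
    (hAA : A * Aᵀ = 1) (hAB : A * Bᵀ = 0) (hsum : Aᵀ * A + Bᵀ * B = 1)
    (hdet : IsUnit M.det) (hQ : IsUnit (B * M * Bᵀ).det) :
    (A * M⁻¹ * Aᵀ)⁻¹ = A * M * Aᵀ - A * M * Bᵀ * (B * M * Bᵀ)⁻¹ * (B * M * Aᵀ) := by
  apply Matrix.inv_eq_right_inv
  set Q := B * M * Bᵀ with hQd
  have hA : Aᵀ * A = 1 - Bᵀ * B := by rw [← hsum]; abel
  have key : Aᵀ * (A * M * Aᵀ - A * M * Bᵀ * Q⁻¹ * (B * M * Aᵀ))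
      = M * (Aᵀ - Bᵀ * Q⁻¹ * (B * M * Aᵀ)) := by
    have e : Aᵀ * (A * M * Aᵀ - A * M * Bᵀ * Q⁻¹ * (B * M * Aᵀ))
      = (Aᵀ * A) * (M * (Aᵀ - Bᵀ * Q⁻¹ * (B * M * Aᵀ))) := by
      simp only [Matrix.mul_sub, Matrix.mul_assoc]
    have z : B * (M * (Aᵀ - Bᵀ * Q⁻¹ * (B * M * Aᵀ))) = 0 := by
      have : B * (M * (Aᵀ - Bᵀ * Q⁻¹ * (B * M * Aᵀ)))
        = B * M * Aᵀ - (Q * Q⁻¹) * (B * M * Aᵀ) := by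
        simp only [hQd, Matrix.mul_sub, Matrix.mul_assoc]
      rw [this, Matrix.mul_nonsing_inv _ hQ, Matrix.one_mul, sub_self]
    rw [e, hA, Matrix.sub_mul, Matrix.one_mul, Matrix.mul_assoc Bᵀ B, z, Matrix.mul_zero, sub_zero]
  rw [Matrix.mul_assoc, key, Matrix.mul_assoc, Matrix.nonsing_inv_mul_cancel_left _ _ hdet,
    Matrix.mul_sub, hAA, Matrix.mul_assoc, ← Matrix.mul_assoc A, hAB, Matrix.zero_mul, sub_zero]

theorem stat_aux {a b k : Type*} [Fintype a] [Fintype b] [Fintype k] [DecidableEq a]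
    [DecidableEq b] [DecidableEq k] (A : Matrix a k ℝ) (B : Matrix b k ℝ) (M : Matrix k k ℝ)
    (hAA : A * Aᵀ = 1) (hBB : B * Bᵀ = 1) (hAB : A * Bᵀ = 0) (hsum : Aᵀ * A + Bᵀ * B = 1)
    (hsym : Mᵀ = M) (hpos : M.PosDef) :
    (M⁻¹)⁻¹ =
      (1 / 2 : ℝ) • (Aᵀ * (A * M⁻¹ * Aᵀ)⁻¹ * A) +
      (1 / 2 : ℝ) • (Bᵀ * (B * M⁻¹ * Bᵀ)⁻¹ * B) +
      (1 / 2 : ℝ) • (Mᵀ * Aᵀ * (A * M * M⁻¹ * Mᵀ * Aᵀ)⁻¹ * (A * M)) +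
      (1 / 2 : ℝ) • (Mᵀ * Bᵀ * (B * M * M⁻¹ * Mᵀ * Bᵀ)⁻¹ * (B * M)) := by
  have hdet : IsUnit M.det := (Matrix.isUnit_iff_isUnit_det _).1 hpos.isUnit
  have hBA : B * Aᵀ = 0 := by
    have := congrArg Matrix.transpose hAB
    simpa [Matrix.transpose_mul] using this
  have hpd : ∀ {c : Type _} [Fintype c] [DecidableEq c] (C : Matrix c k ℝ), C * Cᵀ = 1 →
      IsUnit (C * M * Cᵀ).det := by
    intro c _ _ C hC
    have h : (C * M * Cᴴ).PosDef := by
      apply hpos.mul_mul_conjTranspose_same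
      intro x y hxy
      have := congrArg (fun v => v ᵥ* Cᵀ) hxy
      simpa [Matrix.vecMul_vecMul, hC] using this
    rw [Matrix.conjTranspose_eq_transpose_of_trivial] at h
    exact (Matrix.isUnit_iff_isUnit_det _).1 h.isUnit
  have hP := hpd A hAA
  have hQ : IsUnit (B * M * Bᵀ).det := by
    have h : (B * M * Bᴴ).PosDef := by
      apply hpos.mul_mul_conjTranspose_same
      intro x y hxy
      have := congrArg (fun v => v ᵥ* Bᵀ) hxy
      simpa [Matrix.vecMul_vecMul, hBB] using this
    rw [Matrix.conjTranspose_eq_transpose_of_trivial] at h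
    exact (Matrix.isUnit_iff_isUnit_det _).1 h.isUnit
  rw [schur_aux A B M hAA hAB hsum hdet hQ,
    schur_aux B A M hBB hBA (by rw [add_comm]; exact hsum) hdet hP,
    Matrix.nonsing_inv_nonsing_inv _ hdet, hsym, Matrix.mul_nonsing_inv_cancel_right _ _ hdet,
    Matrix.mul_nonsing_inv_cancel_right _ _ hdet]
  have hAM : A * M = A * M * Aᵀ * A + A * M * Bᵀ * B := by
    rw [Matrix.mul_assoc _ Aᵀ, Matrix.mul_assoc _ Bᵀ, ← Matrix.mul_add, hsum, Matrix.mul_one]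
  have hBM : B * M = B * M * Aᵀ * A + B * M * Bᵀ * B := by
    rw [Matrix.mul_assoc _ Aᵀ, Matrix.mul_assoc _ Bᵀ, ← Matrix.mul_add, hsum, Matrix.mul_one]
  have hMM : M = Aᵀ * (A * M) + Bᵀ * (B * M) := by
    rw [← Matrix.mul_assoc, ← Matrix.mul_assoc, ← Matrix.add_mul, hsum, Matrix.one_mul]
  have hMA : M * Aᵀ = Aᵀ * (A * M * Aᵀ) + Bᵀ * (B * M * Aᵀ) := by
    conv_lhs => rw [hMM]
    simp only [Matrix.add_mul, Matrix.mul_assoc]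
  have hMB : M * Bᵀ = Aᵀ * (A * M * Bᵀ) + Bᵀ * (B * M * Bᵀ) := by
    conv_lhs => rw [hMM]
    simp only [Matrix.add_mul, Matrix.mul_assoc]
  rw [hMA, hMB]
  generalize hPd : A * M * Aᵀ = P at *
  generalize hQd : B * M * Bᵀ = Q at *
  generalize A * M * Bᵀ = X at *
  generalize B * M * Aᵀ = Y at *
  rw [hAM, hBM] at hMM ⊢
  rw [hMM]
  have c1 (Z : Matrix a k ℝ) : P * (P⁻¹ * Z) = Z := Matrix.mul_nonsing_inv_cancel_left _ _ hP
  have c2 (Z : Matrix a k ℝ) : P⁻¹ * (P * Z) = Z := Matrix.nonsing_inv_mul_cancel_left _ _ hP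
  have c3 (Z : Matrix b k ℝ) : Q * (Q⁻¹ * Z) = Z := Matrix.mul_nonsing_inv_cancel_left _ _ hQ
  have c4 (Z : Matrix b k ℝ) : Q⁻¹ * (Q * Z) = Z := Matrix.nonsing_inv_mul_cancel_left _ _ hQ
  simp only [Matrix.mul_add, Matrix.add_mul, Matrix.mul_sub, Matrix.sub_mul, Matrix.mul_assoc,
    c1, c2, c3, c4]
  module

theorem projA_eq (NA NB : ℕ) (i : Fin (2 * NA)) (j : Fin (2 * (NA + NB))) :
    projA NA NB i j = if j = ⟨i, by omega⟩ then 1 else 0 := by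
  simp [projA, Fin.ext_iff]

theorem projB_eq (NA NB : ℕ) (i : Fin (2 * NB)) (j : Fin (2 * (NA + NB))) :
    projB NA NB i j = if j = ⟨2 * NA + i, by omega⟩ then 1 else 0 := by
  simp [projB, Fin.ext_iff]

theorem projAA (NA NB : ℕ) : projA NA NB * (projA NA NB)ᵀ = 1 := by
  ext i j
  simp [Matrix.mul_apply, projA_eq, Matrix.one_apply]
  simp [Fin.ext_iff, eq_comm]

theorem projBB (NA NB : ℕ) : projB NA NB * (projB NA NB)ᵀ = 1 := by
  ext i j
  simp [Matrix.mul_apply, projB_eq, Matrix.one_apply]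
  simp [Fin.ext_iff, eq_comm]

theorem projAB (NA NB : ℕ) : projA NA NB * (projB NA NB)ᵀ = 0 := by
  ext i j
  simp [Matrix.mul_apply, projA_eq, projB_eq]
  omega

theorem proj_sum (NA NB : ℕ) :
    (projA NA NB)ᵀ * projA NA NB + (projB NA NB)ᵀ * projB NA NB = 1 := by
  ext i j
  simp only [Matrix.add_apply, Matrix.mul_apply, Matrix.transpose_apply, Matrix.one_apply]
  by_cases h : (i : ℕ) < 2 * NA
  · rw [Finset.sum_eq_single (⟨i, h⟩ : Fin (2 * NA)), Finset.sum_eq_zero]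
    · simp [projA, Fin.ext_iff, eq_comm]
    · intro x _
      have : (i : ℕ) ≠ 2 * NA + x := by omega
      simp [projB, this]
    · intro x _ hx
      have : (i : ℕ) ≠ x := fun e => hx (Fin.ext e.symm)
      simp [projA, this]
    · simp
  · have hi := i.2
    rw [Finset.sum_eq_zero,
      Finset.sum_eq_single (⟨i - 2 * NA, by omega⟩ : Fin (2 * NB))]
    · have e : 2 * NA + ((i : ℕ) - 2 * NA) = i := by omega
      simp [projB, Fin.ext_iff, e, eq_comm]
    · intro x _ hx
      have : (i : ℕ) ≠ 2 * NA + x := fun e => hx (Fin.ext (by simp; omega))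
      simp [projB, this]
    · simp
    · intro x _
      have : (i : ℕ) ≠ x := by omega
      simp [projA, this]

/-- If `M` is symplectic, symmetric and positive definite, then `Ḡ = M⁻¹` satisfies the
stationarity condition `Ḡ⁻¹ = Σᵢ pᵢ Fᵢᵀ (Fᵢ Ḡ Fᵢᵀ)⁻¹ Fᵢ` for the four subsystems given by
`F_A`, `F_B`, `F_{A'} = F_A M`, `F_{B'} = F_B M` with weights `pᵢ = 1/2`. -/
theorem stationarity_condition (NA NB : ℕ)
    (M : Matrix (Fin (2 * (NA + NB))) (Fin (2 * (NA + NB))) ℝ)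
    (hM : M * stdSymplectic (NA + NB) * Mᵀ = stdSymplectic (NA + NB))
    (hsym : Mᵀ = M) (hpos : M.PosDef) :
    (M⁻¹)⁻¹ =
      (1 / 2 : ℝ) • ((projA NA NB)ᵀ * (projA NA NB * M⁻¹ * (projA NA NB)ᵀ)⁻¹ * projA NA NB) +
      (1 / 2 : ℝ) • ((projB NA NB)ᵀ * (projB NA NB * M⁻¹ * (projB NA NB)ᵀ)⁻¹ * projB NA NB) +
      (1 / 2 : ℝ) • (Mᵀ * (projA NA NB)ᵀ *
        (projA NA NB * M * M⁻¹ * Mᵀ * (projA NA NB)ᵀ)⁻¹ * (projA NA NB * M)) +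
      (1 / 2 : ℝ) • (Mᵀ * (projB NA NB)ᵀ *
        (projB NA NB * M * M⁻¹ * Mᵀ * (projB NA NB)ᵀ)⁻¹ * (projB NA NB * M)) := by
  exact stat_aux (projA NA NB) (projB NA NB) M (projAA NA NB) (projBB NA NB) (projAB NA NB)
    (proj_sum NA NB) hsym hpos
end

section
/- Let λ₁ ≥ λ₂ ≥ ⋯ ≥ λₙ be real numbers and for t ∈ ℝ let D(t) be the n × n diagonal matrix with diagonal entries e^{t·λ₁}, …, e^{t·λₙ}. Let F be a real m × n matrix of rank m (with m ≤ n), and let i₁ < i₂ < ⋯ < i_m be exactly those column indices j ∈ {1,…,n} such that the j-th column of F does not lie in the linear span of columns 1, …, j−1 of F (for a rank-m matrix there are exactly m such indices). Then lim_{t→∞} (1/t)·(1/2)·ln det(F·D(t)²·Fᵀ) = λ_{i₁} + λ_{i₂} + ⋯ + λ_{i_m}. -/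
open Matrix

/-- Subsystem exponent for a diagonal flow `D(t) = diag(e^{tλ₁}, …, e^{tλₙ})` with
`λ₁ ≥ ⋯ ≥ λₙ`: for a rank-`m` matrix `F` whose pivot columns (columns not in the span of
the preceding columns) are `i₁ < ⋯ < i_m`, the volume growth rate
`lim_{t→∞} (1/t)·(1/2)·ln det(F·D(t)²·Fᵀ)` equals `λ_{i₁} + ⋯ + λ_{i_m}`. -/
theorem subsystem_exponent_pivot_columns (m n : ℕ) (hmn : m ≤ n)
    (lam : Fin n → ℝ) (hlam : Antitone lam)
    (F : Matrix (Fin m) (Fin n) ℝ) (hrank : F.rank = m)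
    (idx : Fin m → Fin n) (hmono : StrictMono idx)
    (hpivot : ∀ j : Fin n,
      ((fun a => F a j) ∉
        Submodule.span ℝ ((fun j' : Fin n => fun a => F a j') '' {j' | j' < j})) ↔
      ∃ k, idx k = j) :
    Filter.Tendsto
      (fun t : ℝ => (1 / t) * ((1 / 2) *
        Real.log (F * (Matrix.diagonal fun i => Real.exp (t * lam i)) ^ 2 * Fᵀ).det))
      Filter.atTop (nhds (∑ k, lam (idx k))) := by
  classical
  set P : Matrix (Fin m) (Fin m) ℝ := F.submatrix id idx with hP
  have hspan : ∀ j : Fin n, (fun a => F a j) ∈ Submodule.span ℝ (Set.range P.col) := by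
    intro j
    induction j using WellFoundedLT.induction with
    | _ j ih =>
      by_cases hj : ∃ k, idx k = j
      · obtain ⟨k, rfl⟩ := hj
        exact Submodule.subset_span ⟨k, rfl⟩
      · have h := (not_congr (hpivot j)).2 hj
        rw [not_not] at h
        refine Submodule.span_le.2 ?_ h
        rintro _ ⟨j', hj', rfl⟩
        exact ih j' hj'
  have hPu : IsUnit P.det := by
    have htop : Submodule.span ℝ (Set.range P.col) = ⊤ := by
      apply Submodule.eq_top_of_finrank_eq
      apply le_antisymm (Submodule.finrank_le _)
      rw [Matrix.rank_eq_finrank_span_cols] at hrank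
      have : Submodule.span ℝ (Set.range F.col) ≤ Submodule.span ℝ (Set.range P.col) := by
        refine Submodule.span_le.2 ?_
        rintro _ ⟨j, rfl⟩
        exact hspan j
      have := Submodule.finrank_mono this
      simp only [Module.finrank_fin_fun]
      omega
    rw [← Matrix.isUnit_iff_isUnit_det, ← Matrix.linearIndependent_cols_iff_isUnit]
    exact linearIndependent_of_top_le_span_of_card_eq_finrank htop.ge (by simp)
  have hPP : P⁻¹ * P = 1 := Matrix.nonsing_inv_mul _ hPu
  set G : Matrix (Fin m) (Fin n) ℝ := P⁻¹ * F with hG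
  have hGF : P * G = F := by rw [hG, Matrix.mul_nonsing_inv_cancel_left _ _ hPu]
  have hGp : ∀ k k', G k (idx k') = if k = k' then 1 else 0 := by
    intro k k'
    have := congrFun (congrFun hPP k) k'
    rw [Matrix.one_apply] at this
    rw [← this]
    rfl
  have hG0 : ∀ (k : Fin m) (j : Fin n), j < idx k → G k j = 0 := by
    intro k j
    induction j using WellFoundedLT.induction with
    | _ j ih =>
      intro hjk
      by_cases hj : ∃ k', idx k' = j
      · obtain ⟨k', rfl⟩ := hj
        rw [hGp, if_neg]
        rintro rfl
        exact lt_irrefl _ hjk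
      · have h := (not_congr (hpivot j)).2 hj
        rw [not_not] at h
        let φ : (Fin m → ℝ) →ₗ[ℝ] ℝ := LinearMap.proj k ∘ₗ Matrix.mulVecLin P⁻¹
        have hφ : ∀ j, φ (fun a => F a j) = G k j := fun j => rfl
        have : Submodule.span ℝ ((fun j' : Fin n => fun a => F a j') '' {j' | j' < j})
            ≤ LinearMap.ker φ := by
          refine Submodule.span_le.2 ?_
          rintro _ ⟨j', hj', rfl⟩
          exact ih j' hj' (lt_trans hj' hjk)
        exact this h
  let H : ℝ → Matrix (Fin m) (Fin n) ℝ := fun t =>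
    Matrix.of fun k j => Real.exp (t * (lam j - lam (idx k))) * G k j
  let K : Matrix (Fin m) (Fin n) ℝ :=
    Matrix.of fun k j => if lam j = lam (idx k) then G k j else 0
  have hHK : Filter.Tendsto H Filter.atTop (nhds K) := by
    refine tendsto_pi_nhds.2 fun k => tendsto_pi_nhds.2 fun j => ?_
    change Filter.Tendsto (fun t => Real.exp (t * (lam j - lam (idx k))) * G k j) Filter.atTop
      (nhds (if lam j = lam (idx k) then G k j else 0))
    split_ifs with h
    · simp [h]
    · rcases lt_or_ge j (idx k) with hj | hj
      · simp [hG0 k j hj]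
      · have hlt : lam j - lam (idx k) < 0 := sub_neg.2 (lt_of_le_of_ne (hlam hj) h)
        have h1 : Filter.Tendsto (fun t : ℝ => Real.exp (t * (lam j - lam (idx k))))
            Filter.atTop (nhds 0) :=
          Real.tendsto_exp_atBot.comp (Filter.tendsto_id.atTop_mul_const_of_neg hlt)
        simpa using h1.mul_const (G k j)
  have hKpos : 0 < (K * Kᵀ).det := by
    have : (K * Kᴴ).PosDef := by
      apply Matrix.PosDef.mul_conjTranspose_self
      intro v w hvw
      have key : ∀ (v : Fin m → ℝ) k, (v ᵥ* K) (idx k) = v k := by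
        intro v k
        have : ∀ a, K a (idx k) = if a = k then 1 else 0 := by
          intro a
          by_cases h : a = k
          · subst h; simp [K, hGp]
          · simp [K, hGp, h]
        simp [Matrix.vecMul, dotProduct, this]
      funext k
      rw [← key v k, ← key w k]
      exact congrFun hvw (idx k)
    simpa using this.det_pos
  have hdet : Filter.Tendsto (fun t => (H t * (H t)ᵀ).det) Filter.atTop
      (nhds (K * Kᵀ).det) := by
    have hc : Continuous fun M : Matrix (Fin m) (Fin n) ℝ => (M * Mᵀ).det := by fun_prop
    exact (hc.tendsto K).comp hHK
  have hlog := hdet.log hKpos.ne'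
  have hfac : ∀ t : ℝ, (F * (Matrix.diagonal fun i => Real.exp (t * lam i)) ^ 2 * Fᵀ).det
      = (P.det * Real.exp (t * ∑ k, lam (idx k))) ^ 2 * (H t * (H t)ᵀ).det := by
    intro t
    have hEH : (Matrix.diagonal fun k => Real.exp (t * lam (idx k))) * H t
        = G * Matrix.diagonal fun i => Real.exp (t * lam i) := by
      ext k j
      rw [Matrix.diagonal_mul, Matrix.mul_diagonal]
      simp only [H, Matrix.of_apply]
      rw [← mul_assoc, ← Real.exp_add, mul_comm (G k j)]
      congr 2
      ring
    have hE : (Matrix.diagonal fun k => Real.exp (t * lam (idx k))).det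
        = Real.exp (t * ∑ k, lam (idx k)) := by
      rw [Matrix.det_diagonal, ← Real.exp_sum, Finset.mul_sum]
    have : F * (Matrix.diagonal fun i => Real.exp (t * lam i)) ^ 2 * Fᵀ
        = (P * (Matrix.diagonal fun k => Real.exp (t * lam (idx k)))) * (H t * (H t)ᵀ)
          * (P * (Matrix.diagonal fun k => Real.exp (t * lam (idx k))))ᵀ := by
      have h1 : F * (Matrix.diagonal fun i => Real.exp (t * lam i))
          = P * (Matrix.diagonal fun k => Real.exp (t * lam (idx k))) * H t := by
        rw [Matrix.mul_assoc, hEH, ← Matrix.mul_assoc, hGF]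
      have h2 := congrArg Matrix.transpose h1
      rw [Matrix.transpose_mul, Matrix.diagonal_transpose, Matrix.transpose_mul _ (H t)] at h2
      rw [pow_two, ← Matrix.mul_assoc, Matrix.mul_assoc _ _ Fᵀ, h1, h2]
      simp only [Matrix.mul_assoc]
    rw [this, Matrix.det_mul, Matrix.det_mul, Matrix.det_transpose, Matrix.det_mul, hE]
    ring
  have hinv : Filter.Tendsto (fun t : ℝ => 1 / t) Filter.atTop (nhds 0) := by
    simpa using tendsto_inv_atTop_zero (𝕜 := ℝ)
  have hlim := (hinv.mul ((hlog.const_mul (1 / 2)).const_add (Real.log P.det))).const_add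
    (∑ k, lam (idx k))
  rw [zero_mul, add_zero] at hlim
  refine hlim.congr' ?_
  filter_upwards [hdet.eventually (lt_mem_nhds hKpos), Filter.eventually_gt_atTop 0] with t ht ht0
  have hp : P.det ≠ 0 := hPu.ne_zero
  rw [hfac, Real.log_mul (pow_ne_zero _ (mul_ne_zero hp (Real.exp_ne_zero _))) ht.ne',
    Real.log_pow, Real.log_mul hp (Real.exp_ne_zero _), Real.log_exp]
  push_cast
  field_simp
  ring
end

section
/- Let λ₁ ≥ λ₂ ≥ ⋯ ≥ λₙ be real numbers and for t ∈ ℝ let D(t) be the n × n diagonal matrix with diagonal entries e^{t·λ₁}, …, e^{t·λₙ}. Let F be a real m × n matrix (m ≤ n) such that the m × m submatrix formed by the first m columns of F is invertible. Then lim_{t→∞} (1/t)·(1/2)·ln det(F·D(t)²·Fᵀ) = λ₁ + λ₂ + ⋯ + λ_m, the sum of the m largest exponents. -/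
open Matrix

lemma exp_aux (c g : ℝ) (hc : c ≤ 0) :
    ∃ l, Filter.Tendsto (fun t : ℝ => Real.exp (t * c) * g) Filter.atTop (nhds l) := by
  rcases hc.lt_or_eq with h | h
  · refine ⟨0 * g, Filter.Tendsto.mul_const _ ?_⟩
    exact Real.tendsto_exp_atBot.comp (Filter.tendsto_id.atTop_mul_const_of_neg h)
  · subst h
    exact ⟨g, by simp⟩

/-- Generic subsystem exponent for a diagonal flow `D(t) = diag(e^{tλ₁}, …, e^{tλₙ})` with
`λ₁ ≥ ⋯ ≥ λₙ`: if the `m × m` submatrix formed by the first `m` columns of `F` is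
invertible, the volume growth rate `lim_{t→∞} (1/t)·(1/2)·ln det(F·D(t)²·Fᵀ)` equals the
sum of the `m` largest exponents `λ₁ + ⋯ + λ_m`. -/
theorem subsystem_exponent_generic (m n : ℕ) (hmn : m ≤ n)
    (lam : Fin n → ℝ) (hlam : Antitone lam)
    (F : Matrix (Fin m) (Fin n) ℝ)
    (hinv : IsUnit (F.submatrix id (Fin.castLE hmn)).det) :
    Filter.Tendsto
      (fun t : ℝ => (1 / t) * ((1 / 2) *
        Real.log (F * (Matrix.diagonal fun i => Real.exp (t * lam i)) ^ 2 * Fᵀ).det))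
      Filter.atTop (nhds (∑ i : Fin m, lam (Fin.castLE hmn i))) := by
  set A := F.submatrix id (Fin.castLE hmn) with hA
  set G := A⁻¹ * F with hG
  have hAG : A * G = F := by
    rw [hG, ← Matrix.mul_assoc, Matrix.mul_nonsing_inv _ hinv, Matrix.one_mul]
  have hGsub : ∀ i k, G i (Fin.castLE hmn k) = (1 : Matrix (Fin m) (Fin m) ℝ) i k := by
    intro i k
    rw [← Matrix.nonsing_inv_mul _ hinv, hG]
    simp [Matrix.mul_apply, hA]
  let H : ℝ → Matrix (Fin m) (Fin n) ℝ := fun t => Matrix.of fun i j =>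
    Real.exp (t * (lam j - lam (Fin.castLE hmn i))) * G i j
  have hlim : ∀ i j, ∃ l, Filter.Tendsto (fun t => H t i j) Filter.atTop (nhds l) := by
    intro i j
    by_cases hj : (j : ℕ) < m
    · have hjk : j = Fin.castLE hmn ⟨j, hj⟩ := rfl
      by_cases hij : i = ⟨j, hj⟩
      · refine exp_aux _ _ ?_
        rw [hij, ← hjk, sub_self]
      · have h0 : G i j = 0 := by
          rw [hjk, hGsub, Matrix.one_apply_ne hij]
        exact ⟨0, by simp [H, h0]⟩
    · refine exp_aux _ _ (sub_nonpos.2 (hlam ?_))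
      rw [Fin.le_def, Fin.val_castLE]
      omega
  choose L hL using hlim
  let L' : Matrix (Fin m) (Fin n) ℝ := Matrix.of L
  have hHL : Filter.Tendsto H Filter.atTop (nhds L') :=
    tendsto_pi_nhds.2 fun i => tendsto_pi_nhds.2 fun j => hL i j
  have hLsub : ∀ i k, L i (Fin.castLE hmn k) = (1 : Matrix (Fin m) (Fin m) ℝ) i k := by
    intro i k
    refine tendsto_nhds_unique (hL i _) ?_
    have : (fun t => H t i (Fin.castLE hmn k)) =
        fun _ => (1 : Matrix (Fin m) (Fin m) ℝ) i k := by
      funext t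
      by_cases hik : i = k
      · subst hik; simp [H, hGsub]
      · simp [H, hGsub, Matrix.one_apply_ne hik]
    rw [this]
    exact tendsto_const_nhds
  have hpos : 0 < (L' * L'ᵀ).det := by
    have hinj : Function.Injective L'.vecMul := by
      intro v w hvw
      funext k
      have := congrFun hvw (Fin.castLE hmn k)
      simpa [Matrix.vecMul, dotProduct, L', hLsub, Matrix.one_apply] using this
    have := (Matrix.PosDef.mul_conjTranspose_self L' hinj).det_pos
    simpa [Matrix.conjTranspose_eq_transpose_of_trivial] using this
  have hdet : Filter.Tendsto (fun t => (H t * (H t)ᵀ).det) Filter.atTop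
      (nhds (L' * L'ᵀ).det) := by
    have hc : Continuous fun X : Matrix (Fin m) (Fin n) ℝ => (X * Xᵀ).det := by fun_prop
    exact (hc.tendsto L').comp hHL
  have hA0 : A.det ≠ 0 := hinv.ne_zero
  set S := ∑ i : Fin m, lam (Fin.castLE hmn i) with hS
  have key : ∀ t : ℝ, (F * (Matrix.diagonal fun i => Real.exp (t * lam i)) ^ 2 * Fᵀ).det
      = A.det ^ 2 * Real.exp (t * S) ^ 2 * (H t * (H t)ᵀ).det := by
    intro t
    let D1 : Matrix (Fin m) (Fin m) ℝ :=
      Matrix.diagonal fun i => Real.exp (t * lam (Fin.castLE hmn i))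
    have h1 : F * (Matrix.diagonal fun i => Real.exp (t * lam i)) = A * D1 * H t := by
      rw [← hAG, Matrix.mul_assoc A G, Matrix.mul_assoc A D1]
      congr 1
      ext i j
      simp only [D1, H, Matrix.mul_diagonal, Matrix.diagonal_mul, Matrix.of_apply]
      rw [← mul_assoc, ← Real.exp_add, mul_comm]
      congr 2
      ring
    have h2 : F * (Matrix.diagonal fun i => Real.exp (t * lam i)) ^ 2 * Fᵀ
        = (A * D1) * (H t * (H t)ᵀ) * (A * D1)ᵀ := by
      have : F * (Matrix.diagonal fun i => Real.exp (t * lam i)) ^ 2 * Fᵀ =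
          (F * (Matrix.diagonal fun i => Real.exp (t * lam i))) *
          (F * (Matrix.diagonal fun i => Real.exp (t * lam i)))ᵀ := by
        rw [Matrix.transpose_mul, Matrix.diagonal_transpose, pow_two]
        simp only [Matrix.mul_assoc]
      rw [this, h1, Matrix.transpose_mul (A * D1)]
      simp only [Matrix.mul_assoc]
    have h3 : D1.det = Real.exp (t * S) := by
      rw [Matrix.det_diagonal, hS, Finset.mul_sum, Real.exp_sum]
    rw [h2, Matrix.det_mul, Matrix.det_mul, Matrix.det_transpose, Matrix.det_mul, h3]
    ring
  have hlog := hdet.log hpos.ne'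
  have hmain : Filter.Tendsto (fun t : ℝ => S + t⁻¹ * ((1 / 2) *
      (Real.log (A.det ^ 2) + Real.log (H t * (H t)ᵀ).det))) Filter.atTop (nhds S) := by
    have := (tendsto_inv_atTop_zero (𝕜 := ℝ)).mul
      ((hlog.const_add (Real.log (A.det ^ 2))).const_mul (1 / 2))
    simpa using this.const_add S
  refine hmain.congr' ?_
  filter_upwards [hdet.eventually (lt_mem_nhds hpos), Filter.eventually_gt_atTop 0]
    with t ht ht0
  rw [key, Real.log_mul (by positivity) ht.ne', Real.log_mul (by positivity) (by positivity),
    Real.log_pow (n := 2) (x := Real.exp (t * S)), Real.log_exp]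
  field_simp
  push_cast
  ring
end

section
/- For every real t the following hold: (i) for all real numbers a ≥ 1, c ≥ 1 and b > 0, d > 0 one has (b·c + a·d·t²)·(a·b + c·d·t²) ≥ a·b²·c; (ii) the infimum over all such a, b, c, d of (1/2)·ln( (b·c + a·d·t²)·(a·b + c·d·t²) / (a·b²·c) ) equals 0. -/
/-- For the metastable two-mode Hamiltonian counterexample: at every fixed time `t`,
(i) for all `a, c ≥ 1` and `b, d > 0` one has
`(bc + adt²)·(ab + cdt²) ≥ ab²c`, and
(ii) the infimum over all such `a, b, c, d` of
`(1/2)·ln((bc + adt²)(ab + cdt²)/(ab²c))` equals `0`. -/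
theorem metastable_counterexample (t : ℝ) :
    (∀ a b c d : ℝ, 1 ≤ a → 1 ≤ c → 0 < b → 0 < d →
      (b * c + a * d * t ^ 2) * (a * b + c * d * t ^ 2) ≥ a * b ^ 2 * c) ∧
    IsGLB {x : ℝ | ∃ a b c d : ℝ, 1 ≤ a ∧ 1 ≤ c ∧ 0 < b ∧ 0 < d ∧
      x = (1 / 2) * Real.log
        ((b * c + a * d * t ^ 2) * (a * b + c * d * t ^ 2) / (a * b ^ 2 * c))} 0 := by
  have key : ∀ a b c d : ℝ, 1 ≤ a → 1 ≤ c → 0 < b → 0 < d →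
      (b * c + a * d * t ^ 2) * (a * b + c * d * t ^ 2) ≥ a * b ^ 2 * c := by
    intro a b c d ha hc hb hd
    have ha' : 0 < a := by linarith
    have hc' : 0 < c := by linarith
    have h : 0 ≤ b * c * (c * d * t ^ 2) + a * d * t ^ 2 * (a * b)
        + a * d * t ^ 2 * (c * d * t ^ 2) := by positivity
    nlinarith [h]
  refine ⟨key, ?_, ?_⟩
  · rintro x ⟨a, b, c, d, ha, hc, hb, hd, rfl⟩
    have ha' : 0 < a := by linarith
    have hc' : 0 < c := by linarith
    have hp : 0 < a * b ^ 2 * c := by positivity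
    have h1 := Real.log_nonneg ((one_le_div hp).2 (key a b c d ha hc hb hd))
    linarith
  · intro y hy
    by_contra! hpos
    have ht : 0 < t ^ 2 + 1 := by positivity
    have hd : 0 < y / (t ^ 2 + 1) := by positivity
    have h := hy ⟨1, 1, 1, y / (t ^ 2 + 1), le_refl _, le_refl _, one_pos, hd, rfl⟩
    have e : (1 * 1 + 1 * (y / (t ^ 2 + 1)) * t ^ 2) * (1 * 1 + 1 * (y / (t ^ 2 + 1)) * t ^ 2)
        / (1 * 1 ^ 2 * 1) = (1 + y / (t ^ 2 + 1) * t ^ 2) ^ 2 := by ring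
    rw [e, Real.log_pow] at h
    have hl := Real.log_le_sub_one_of_pos
      (show 0 < 1 + y / (t ^ 2 + 1) * t ^ 2 by positivity)
    have h3 : y / (t ^ 2 + 1) * (t ^ 2 + 1) = y := div_mul_cancel₀ _ ht.ne'
    push_cast at h
    linarith
end

section
/- Let N = N_A + N_B, let Ω = Ω_{2N_A} ⊕ Ω_{2N_B} be the standard symplectic matrix written block-diagonally with respect to the splitting of the 2N coordinates into the first 2N_A and the last 2N_B, and let M be a real symplectic 2N × 2N matrix (M Ω Mᵀ = Ω). Then the determinant of the top-left 2N_A × 2N_A block of M·Mᵀ equals the determinant of the bottom-right 2N_B × 2N_B block of M·Mᵀ. -/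
open Matrix

theorem stdSymplectic_sq (N : ℕ) : stdSymplectic N * stdSymplectic N = -1 := by
  ext i j
  rw [Matrix.mul_apply]
  have hi := i.isLt
  have hj := j.isLt
  let k : Fin (2 * N) := ⟨if (i : ℕ) % 2 = 0 then i + 1 else i - 1, by split_ifs <;> omega⟩
  have hk : (k : ℕ) = if (i : ℕ) % 2 = 0 then (i : ℕ) + 1 else i - 1 := rfl
  rw [Finset.sum_eq_single k]
  · simp only [stdSymplectic, Matrix.of_apply, Matrix.neg_apply, Matrix.one_apply, Fin.ext_iff]
    rw [hk]
    rcases Nat.mod_two_eq_zero_or_one i with h | h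
    · simp only [h, if_true, and_self]
      split_ifs <;> first | omega | norm_num
    · simp only [h, one_ne_zero, if_false]
      split_ifs <;> first | omega | norm_num
  · intro b _ hb
    have hb' : (b : ℕ) ≠ k := fun h => hb (Fin.ext h)
    rw [hk] at hb'
    have : stdSymplectic N i b = 0 := by
      simp only [stdSymplectic, Matrix.of_apply]
      split_ifs at hb' ⊢ <;> first | omega | rfl
    rw [this, zero_mul]
  · simp

theorem block_aux {m n : Type*} [Fintype m] [Fintype n] [DecidableEq m] [DecidableEq n]
    (A : Matrix m m ℝ) (B : Matrix m n ℝ) (C : Matrix n m ℝ) (D : Matrix n n ℝ)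
    (J : Matrix m m ℝ) (K : Matrix n n ℝ) (hK : K * K = -1)
    (hdet : (fromBlocks A B C D).det = 1)
    (h : fromBlocks A B C D * fromBlocks J 0 0 K * fromBlocks A B C D = fromBlocks J 0 0 K) :
    A.det = D.det := by
  simp only [fromBlocks_multiply, Matrix.mul_zero, add_zero, zero_add] at h
  obtain ⟨-, h12, -, h22⟩ := fromBlocks_inj.1 h
  have key : fromBlocks A B C D * fromBlocks 1 (-(J * B * K)) 0 (-(K * D * K)) =
      fromBlocks A 0 C 1 := by
    rw [fromBlocks_multiply]
    congr 1
    · simp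
    · have := congrArg (· * K) h12
      simp only [Matrix.add_mul, Matrix.zero_mul] at this
      simp only [Matrix.mul_neg, ← neg_add, ← Matrix.mul_assoc, this, neg_zero]
    · simp
    · have := congrArg (· * K) h22
      simp only [Matrix.add_mul, hK] at this
      simp only [Matrix.mul_neg, ← neg_add, ← Matrix.mul_assoc, this, neg_neg]
  have hd := congrArg Matrix.det key
  rw [det_mul, hdet, det_fromBlocks_zero₂₁, det_fromBlocks_zero₁₂, det_one, det_one,
    one_mul, one_mul, mul_one] at hd
  rw [← hd, ← Matrix.neg_mul, det_mul, ← Matrix.neg_mul, det_mul]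
  have : (-K).det * K.det = 1 := by rw [← det_mul, Matrix.neg_mul, hK, neg_neg, det_one]
  linear_combination D.det * this

/-- For a symplectic matrix `M` on `2(N_A+N_B)` coordinates, the determinant of the
top-left `2N_A × 2N_A` block of `M·Mᵀ` equals the determinant of the bottom-right
`2N_B × 2N_B` block of `M·Mᵀ`, expressing the equality `S₂(A) = S₂(B)` of the Rényi-2
entropies of complementary subsystems of a pure Gaussian state. -/
theorem complementary_block_determinants (NA NB : ℕ)
    (M : Matrix (Fin (2 * (NA + NB))) (Fin (2 * (NA + NB))) ℝ)
    (hM : M * stdSymplectic (NA + NB) * Mᵀ = stdSymplectic (NA + NB)) :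
    ((M * Mᵀ).submatrix (fun i : Fin (2 * NA) => Fin.castLE (by omega) i)
        (fun j : Fin (2 * NA) => Fin.castLE (by omega) j)).det =
      ((M * Mᵀ).submatrix
        (fun i : Fin (2 * NB) => (⟨2 * NA + i, by have := i.isLt; omega⟩ : Fin (2 * (NA + NB))))
        (fun j : Fin (2 * NB) => (⟨2 * NA + j, by have := j.isLt; omega⟩ : Fin (2 * (NA + NB))))).det := by
  set W := stdSymplectic (NA + NB) with hW
  have hsq : W * W = -1 := stdSymplectic_sq _
  have h1 : M * (-(W * Mᵀ * W)) = 1 := by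
    rw [Matrix.mul_neg, ← Matrix.mul_assoc, ← Matrix.mul_assoc, hM, hsq, neg_neg]
  have h2 : W * Mᵀ * W * M = -1 := by
    have := mul_eq_one_comm.1 h1
    rw [Matrix.neg_mul] at this
    rw [← this, neg_neg]
  have h3 : Mᵀ * W * M = W := by
    have := congrArg (W * ·) h2
    simp only [← Matrix.mul_assoc, hsq, Matrix.neg_mul, Matrix.one_mul, Matrix.mul_neg,
      Matrix.mul_one, neg_inj] at this
    exact this
  have hS : (M * Mᵀ) * W * (M * Mᵀ) = W := by
    calc (M * Mᵀ) * W * (M * Mᵀ) = M * (Mᵀ * W * M) * Mᵀ := by simp only [Matrix.mul_assoc]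
      _ = W := by rw [h3, hM]
  have hWd : W.det ≠ 0 := by
    have : (-W).det * W.det = 1 := by rw [← det_mul, Matrix.neg_mul, hsq, neg_neg, det_one]
    exact right_ne_zero_of_mul (this ▸ one_ne_zero)
  have hSd : (M * Mᵀ).det = 1 := by
    have := congrArg Matrix.det hM
    rw [det_mul, det_mul] at this
    rw [det_mul]
    apply mul_right_cancel₀ hWd
    linear_combination this
  generalize M * Mᵀ = S at hS hSd
  let e : Fin (2 * NA) ⊕ Fin (2 * NB) ≃ Fin (2 * (NA + NB)) :=
    finSumFinEquiv.trans (finCongr (by ring))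
  have hWe : W.submatrix e e = fromBlocks (stdSymplectic NA) 0 0 (stdSymplectic NB) := by
    ext i j
    rcases i with i | i <;> rcases j with j | j <;>
      simp only [hW, e, stdSymplectic, submatrix_apply, Equiv.trans_apply, of_apply,
        finSumFinEquiv_apply_left, finSumFinEquiv_apply_right, finCongr_apply, Fin.val_cast,
        Fin.val_castAdd, Fin.val_natAdd, fromBlocks_apply₁₁, fromBlocks_apply₁₂,
        fromBlocks_apply₂₁, fromBlocks_apply₂₂, Matrix.zero_apply] <;>
      have hi := i.isLt <;> have hj := j.isLt <;>
      split_ifs <;> first | rfl | omega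
  have hSe := fromBlocks_toBlocks (S.submatrix e e)
  refine block_aux (S.submatrix e e).toBlocks₁₁ (S.submatrix e e).toBlocks₁₂
    (S.submatrix e e).toBlocks₂₁ (S.submatrix e e).toBlocks₂₂ (stdSymplectic NA)
    (stdSymplectic NB) (stdSymplectic_sq NB) ?_ ?_
  · rw [hSe, det_submatrix_equiv_self, hSd]
  · rw [hSe, ← hWe, submatrix_mul_equiv, submatrix_mul_equiv, hS]
end
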